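/- (Strassen's theorem for martingales) Let μ, ν ∈ P₁(ℝ^d). Then μ ≼_c ν if and only if there exists a martingale coupling between μ and ν, that is, a coupling π ∈ Π(μ,ν) such that x = ∫_{ℝ^d} y dπ_x(y) for μ-almost every x ∈ ℝ^d. -/

import Mathlib

open MeasureTheory Set Filter Topology
open scoped ENNReal

noncomputable section

/-- `ℝ^d`, modelled as Euclidean space. -/
abbrev Rd (d : ℕ) : Type := EuclideanSpace ℝ (Fin d)

/-- A Borel measure on `ℝ^d` has finite `p`-th moment. -/
def HasMomentP (p : ℝ) {d : ℕ} (ρ : Measure (Rd d)) : Prop :=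
  ∫⁻ y, ENNReal.ofReal (‖y‖ ^ p) ∂ρ ≠ ⊤

/-- `P_p(ℝ^d)`: Borel probability measures on `ℝ^d` with finite `p`-th moment. -/
abbrev Pp (p : ℝ) (d : ℕ) : Type :=
  {ρ : Measure (Rd d) // IsProbabilityMeasure ρ ∧ HasMomentP p ρ}

/-- Continuous test functions of growth of order at most `p`. -/
def GrowthP (p : ℝ) {d : ℕ} (f : Rd d → ℝ) : Prop :=
  Continuous f ∧ ∃ K : ℝ, ∀ y, |f y| ≤ K * (1 + ‖y‖ ^ p)

/-- The `p`-weak topology on `P_p(ℝ^d)`: the initial topology induced by integration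
against continuous functions of growth of order at most `p`. -/
instance PpTopology (p : ℝ) (d : ℕ) : TopologicalSpace (Pp p d) :=
  ⨅ f : {f : Rd d → ℝ // GrowthP p f},
    TopologicalSpace.induced (fun ρ : Pp p d => ∫ y, f.1 y ∂ρ.1) inferInstance

instance PpMeasurableSpace (p : ℝ) (d : ℕ) : MeasurableSpace (Pp p d) := borel _

/-- `C_{b,p}(ℝ^d)`: continuous functions bounded from below by a constant and bounded
above by `K (1 + |y - y₀|^p)` for some `K > 0`, `y₀`. -/
def Cbp (p : ℝ) {d : ℕ} (ψ : Rd d → ℝ) : Prop :=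
  Continuous ψ ∧ (∃ c : ℝ, ∀ y, c ≤ ψ y) ∧
    ∃ K : ℝ, 0 < K ∧ ∃ y₀ : Rd d, ∀ y, ψ y ≤ K * (1 + ‖y - y₀‖ ^ p)

open scoped Classical in
/-- The nonnegative part of an extended real, as an extended nonnegative real. -/
def erealToENN (x : EReal) : ℝ≥0∞ := if x = ⊤ then ⊤ else ENNReal.ofReal x.toReal

/-- Canonical extended integral of an `EReal`-valued function: the lower integral of the
positive part minus the lower integral of the negative part. -/
def eInt {α : Type*} [MeasurableSpace α] (μ : Measure α) (f : α → EReal) : EReal :=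
  ((∫⁻ x, erealToENN (f x) ∂μ : ℝ≥0∞) : EReal) -
    ((∫⁻ x, erealToENN (-(f x)) ∂μ : ℝ≥0∞) : EReal)

/-- The convex order on measures on `ℝ^d`: `ρ₁ ≼_c ρ₂` iff `∫ f dρ₁ ≤ ∫ f dρ₂` for every
convex function `f : ℝ^d → ℝ` (integrals taken in the extended sense). -/
def ConvexOrder {d : ℕ} (ρ₁ ρ₂ : Measure (Rd d)) : Prop :=
  ∀ f : Rd d → ℝ, ConvexOn ℝ univ f →
    eInt ρ₁ (fun y => (f y : EReal)) ≤ eInt ρ₂ (fun y => (f y : EReal))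

/-- Coordinatewise increasing functions on `ℝ^d`. -/
def CoordMono {d : ℕ} (f : Rd d → ℝ) : Prop :=
  ∀ y z : Rd d, (∀ i, y i ≤ z i) → f y ≤ f z

/-- The increasing convex order on measures on `ℝ^d`. -/
def IcxOrder {d : ℕ} (ρ₁ ρ₂ : Measure (Rd d)) : Prop :=
  ∀ f : Rd d → ℝ, ConvexOn ℝ univ f → CoordMono f →
    eInt ρ₁ (fun y => (f y : EReal)) ≤ eInt ρ₂ (fun y => (f y : EReal))

/-- `π` is a coupling of `μ` and `ν`. -/
def IsCoupling {X Y : Type*} [MeasurableSpace X] [MeasurableSpace Y]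
    (π : Measure (X × Y)) (μ : Measure X) (ν : Measure Y) : Prop :=
  IsProbabilityMeasure π ∧ π.map Prod.fst = μ ∧ π.map Prod.snd = ν

open scoped Classical in
/-- Disintegration of a measure on a product space with respect to its first marginal. -/
def disint {X : Type*} [MeasurableSpace X] {Y : Type*} [MeasurableSpace Y]
    [StandardBorelSpace Y] [Nonempty Y] (π : Measure (X × Y)) :
    ProbabilityTheory.Kernel X Y :=
  if h : IsFiniteMeasure π then (haveI := h; π.condKernel) else 0

/-- The primal weak optimal transport value `inf_{π ∈ Π(μ,ν)} ∫ C(x, π_x) dμ(x)`. -/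
def primal {X : Type*} [MeasurableSpace X] {d : ℕ}
    (μ : Measure X) (ν : Measure (Rd d)) (C : X → Measure (Rd d) → ℝ≥0∞) : ℝ≥0∞ :=
  ⨅ π : {π : Measure (X × Rd d) // IsCoupling π μ ν}, ∫⁻ x, C x (disint π.1 x) ∂μ

/-- The `C`-conjugate `ψ^C (x) = inf_{ρ ∈ P_p} ρ(ψ) + C(x, ρ)`. -/
def conj (p : ℝ) {X : Type*} [MeasurableSpace X] {d : ℕ}
    (C : X → Measure (Rd d) → ℝ≥0∞) (ψ : Rd d → ℝ) (x : X) : EReal :=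
  ⨅ ρ : Pp p d, ((∫ y, ψ y ∂ρ.1 : ℝ) : EReal) + ((C x ρ.1 : ℝ≥0∞) : EReal)

/-- The dual value `μ(ψ^C) - ν(ψ)`. -/
def dualVal (p : ℝ) {X : Type*} [MeasurableSpace X] {d : ℕ}
    (μ : Measure X) (ν : Measure (Rd d)) (C : X → Measure (Rd d) → ℝ≥0∞)
    (ψ : Rd d → ℝ) : EReal :=
  eInt μ (conj p C ψ) - ((∫ y, ψ y ∂ν : ℝ) : EReal)

end

open scoped CompactlySupported

lemma erealToENN_coe (r : ℝ) : erealToENN (r : EReal) = ENNReal.ofReal r := by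
  simp [erealToENN]

lemma eInt_coe {α : Type*} [MeasurableSpace α] (μ : Measure α) (f : α → ℝ) :
    eInt μ (fun x => (f x : EReal)) =
      ((∫⁻ x, ENNReal.ofReal (f x) ∂μ : ℝ≥0∞) : EReal) -
        ((∫⁻ x, ENNReal.ofReal (-f x) ∂μ : ℝ≥0∞) : EReal) := by
  simp only [eInt, ← EReal.coe_neg, erealToENN_coe]

lemma eInt_coe_mono {α : Type*} [MeasurableSpace α] {μ : Measure α} {f g : α → ℝ}
    (h : ∀ᵐ x ∂μ, f x ≤ g x) :
    eInt μ (fun x => (f x : EReal)) ≤ eInt μ (fun x => (g x : EReal)) := by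
  rw [eInt_coe, eInt_coe]
  apply EReal.sub_le_sub
  · refine EReal.coe_ennreal_le_coe_ennreal_iff.2 (lintegral_mono_ae ?_)
    filter_upwards [h] with x hx using ENNReal.ofReal_le_ofReal hx
  · refine EReal.coe_ennreal_le_coe_ennreal_iff.2 (lintegral_mono_ae ?_)
    filter_upwards [h] with x hx using ENNReal.ofReal_le_ofReal (neg_le_neg hx)

lemma eInt_coe_of_integrable {α : Type*} [MeasurableSpace α] {μ : Measure α} {f : α → ℝ}
    (hf : Integrable f μ) :
    eInt μ (fun x => (f x : EReal)) = ((∫ x, f x ∂μ : ℝ) : EReal) := by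
  have h₁ := hf.lintegral_lt_top
  have h₂ := hf.neg.lintegral_lt_top
  simp only [Pi.neg_apply] at h₂
  rw [eInt_coe, integral_eq_lintegral_pos_part_sub_lintegral_neg_part hf, EReal.coe_sub,
    EReal.coe_ennreal_toReal h₁.ne, EReal.coe_ennreal_toReal h₂.ne]

lemma HasMomentP.integrable_norm {d : ℕ} {μ : Measure (Rd d)} (h : HasMomentP 1 μ) :
    Integrable (fun x => ‖x‖) μ := by
  refine ⟨by fun_prop, ?_⟩
  rw [hasFiniteIntegral_iff_ofReal (by filter_upwards with x using norm_nonneg x)]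
  simpa [HasMomentP, lt_top_iff_ne_top] using h

/-- The convex order forces nonnegativity of `∫ φ dμ + ∫ ψ dν` as soon as
`φ(x) + ψ(y) + ⟪h(x), y - x⟫` is nonnegative: the infimum over `x` of the affine functions
`φ(x) + ⟪h(x), · - x⟫` is a concave function between `-ψ` and `φ`. -/
lemma ConvexOrder.integral_add_integral_nonneg {d : ℕ} {μ ν : Measure (Rd d)}
    (hc : ConvexOrder μ ν) {φ ψ : Rd d → ℝ} {h : Rd d → Rd d}
    (hφ : Integrable φ μ) (hψ : Integrable ψ ν)
    (hpos : ∀ x y, 0 ≤ φ x + ψ y + inner ℝ (h x) (y - x)) :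
    0 ≤ ∫ x, φ x ∂μ + ∫ y, ψ y ∂ν := by
  set k : Rd d → ℝ := fun y => ⨆ x, -(φ x + inner ℝ (h x) (y - x)) with hk
  have hbdd (y : Rd d) : BddAbove (Set.range fun x => -(φ x + inner ℝ (h x) (y - x))) := by
    refine ⟨ψ y, ?_⟩
    rintro _ ⟨x, rfl⟩
    linarith [hpos x y]
  have hkψ (y : Rd d) : k y ≤ ψ y := ciSup_le fun x => by linarith [hpos x y]
  have hφk (x : Rd d) : -φ x ≤ k x := by
    have h₀ := le_ciSup (hbdd x) x
    rwa [sub_self, inner_zero_right, add_zero] at h₀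
  have hconv : ConvexOn ℝ univ k := by
    refine ⟨convex_univ, fun y _ z _ a b ha hb hab => ciSup_le fun x => ?_⟩
    have hy := mul_le_mul_of_nonneg_left (le_ciSup (hbdd y) x) ha
    have hz := mul_le_mul_of_nonneg_left (le_ciSup (hbdd z) x) hb
    have hsplit : a • y + b • z - x = a • (y - x) + b • (z - x) := by
      obtain rfl : b = 1 - a := by linarith
      module
    rw [hsplit, inner_add_right, inner_smul_right, inner_smul_right, smul_eq_mul, smul_eq_mul]
    have hφx : φ x = a * φ x + b * φ x := by rw [← add_mul, hab, one_mul]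
    change a * _ ≤ a * k y at hy
    change b * _ ≤ b * k z at hz
    linarith
  have key := (eInt_coe_mono (Eventually.of_forall hφk)).trans
    ((hc k hconv).trans (eInt_coe_mono (Eventually.of_forall hkψ)))
  have hneg := eInt_coe_of_integrable hφ.neg
  simp only [Pi.neg_apply] at hneg
  rw [hneg, eInt_coe_of_integrable hψ, EReal.coe_le_coe_iff, integral_neg] at key
  linarith

/-- The space of integrable real functions, as a subspace of all functions. -/
def integrableSubmodule {α : Type*} [MeasurableSpace α] (μ : Measure α) :
    Submodule ℝ (α → ℝ) where
  carrier := {φ | Integrable φ μ}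
  add_mem' := fun h₁ h₂ => h₁.add h₂
  zero_mem' := integrable_zero _ _ _
  smul_mem' := fun c _ h => h.smul c

/-- Integration as a linear functional on the space of integrable functions. -/
noncomputable def integralLinear {α : Type*} [MeasurableSpace α] (μ : Measure α) :
    integrableSubmodule μ →ₗ[ℝ] ℝ where
  toFun φ := ∫ x, φ.1 x ∂μ
  map_add' φ ψ := integral_add φ.2 ψ.2
  map_smul' c φ := integral_const_mul c φ.1

/-- The cone of those `((φ, ψ, h), F)` for which `φ(x) + ψ(y) + ⟪h(x), y - x⟫ + F(x, y)` is
nonnegative. -/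
def martingaleCone {d : ℕ} (μ ν : Measure (Rd d)) :
    PointedCone ℝ ((integrableSubmodule μ × integrableSubmodule ν × (Rd d → Rd d)) ×
      C_c(Rd d × Rd d, ℝ)) where
  carrier := {e | ∀ x y,
    0 ≤ e.1.1.1 x + e.1.2.1.1 y + inner ℝ (e.1.2.2 x) (y - x) + e.2 (x, y)}
  add_mem' := by
    intro a b ha hb x y
    have := ha x y
    have := hb x y
    simp only [Prod.fst_add, Prod.snd_add, Submodule.coe_add, Pi.add_apply, inner_add_left,
      CompactlySupportedContinuousMap.coe_add]
    linarith
  zero_mem' := by intro x y; simp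
  smul_mem' := by
    intro c a ha x y
    have := mul_nonneg c.2 (ha x y)
    have hc : c • a = (c : ℝ) • a := rfl
    rw [hc]
    simp only [Prod.smul_fst, Prod.smul_snd, Submodule.coe_smul, Pi.smul_apply,
      real_inner_smul_left, CompactlySupportedContinuousMap.coe_smul, smul_eq_mul]
    linarith

lemma ConvexOrder.exists_positiveLinearMap {d : ℕ} {μ ν : Measure (Rd d)}
    [IsProbabilityMeasure μ] (hc : ConvexOrder μ ν) :
    ∃ Λ : C_c(Rd d × Rd d, ℝ) →ₚ[ℝ] ℝ, ∀ (φ ψ : Rd d → ℝ) (h : Rd d → Rd d)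
      (F : C_c(Rd d × Rd d, ℝ)), Integrable φ μ → Integrable ψ ν →
      (∀ x y, F (x, y) ≤ φ x + ψ y + inner ℝ (h x) (y - x)) →
      Λ F ≤ ∫ x, φ x ∂μ + ∫ y, ψ y ∂ν := by
  let E := (integrableSubmodule μ × integrableSubmodule ν × (Rd d → Rd d)) ×
      C_c(Rd d × Rd d, ℝ)
  let L : E →ₗ[ℝ] ℝ := (integralLinear μ ∘ₗ LinearMap.fst ℝ _ _ +
    integralLinear ν ∘ₗ LinearMap.fst ℝ _ _ ∘ₗ LinearMap.snd ℝ _ _) ∘ₗ LinearMap.fst ℝ _ _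
  have hL (e : E) : L e = ∫ x, e.1.1.1 x ∂μ + ∫ y, e.1.2.1.1 y ∂ν := rfl
  obtain ⟨g, hgL, hg⟩ := riesz_extension (martingaleCone μ ν)
    (L.toPMap (Submodule.prod ⊤ ⊥)) (by
      intro e' hpos
      obtain ⟨e, _, he⟩ := e'
      have hpos : ∀ x y, 0 ≤ e.1.1.1 x + e.1.2.1.1 y + inner ℝ (e.1.2.2 x) (y - x) + e.2 (x, y) :=
        hpos
      have he : e.2 = 0 := he
      change 0 ≤ L e
      rw [hL]
      refine hc.integral_add_integral_nonneg (h := e.1.2.2) e.1.1.2 e.1.2.1.2 fun x y => ?_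
      have := hpos x y
      simpa [he] using this) (by
      rintro ⟨w, F⟩
      obtain ⟨C, hC⟩ := F.hasCompactSupport.exists_bound_of_continuous F.continuous
      refine ⟨⟨(-w + (⟨fun _ => C, integrable_const _⟩, 0, 0), 0), trivial, rfl⟩, ?_⟩
      intro x y
      have := (abs_le.1 (hC (x, y))).1
      simp
      linarith)
  refine ⟨PositiveLinearMap.mk₀ (g ∘ₗ LinearMap.inr ℝ _ _) fun F hF => hg _ fun x y => ?_, ?_⟩
  · simpa using hF (x, y)
  · intro φ ψ h F hφ hψ hle
    have h₁ : 0 ≤ g ((⟨φ, hφ⟩, ⟨ψ, hψ⟩, h), -F) := hg _ fun x y => by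
      have := hle x y
      simp
      linarith
    have h₂ : g ((⟨φ, hφ⟩, ⟨ψ, hψ⟩, h), 0) = ∫ x, φ x ∂μ + ∫ y, ψ y ∂ν :=
      hgL ⟨((⟨φ, hφ⟩, ⟨ψ, hψ⟩, h), 0), trivial, rfl⟩
    have h₃ : (((⟨φ, hφ⟩, ⟨ψ, hψ⟩, h), -F) : E) = ((⟨φ, hφ⟩, ⟨ψ, hψ⟩, h), 0) - (0, F) := by
      rw [Prod.mk_sub_mk, sub_zero, zero_sub]
    rw [h₃, map_sub, h₂] at h₁
    exact sub_nonneg.1 h₁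

/-- A continuous cutoff: `1` on the ball of radius `n`, `0` outside the ball of radius `n + 1`. -/
noncomputable def ballCutoff {E : Type*} [NormedAddCommGroup E] (n : ℕ) (z : E) : ℝ :=
  max 0 (min 1 (n + 1 - ‖z‖))

section BallCutoff

variable {E : Type*} [NormedAddCommGroup E]

lemma continuous_ballCutoff (n : ℕ) : Continuous (ballCutoff n : E → ℝ) := by
  unfold ballCutoff
  fun_prop

lemma ballCutoff_nonneg (n : ℕ) (z : E) : 0 ≤ ballCutoff n z := le_max_left _ _

lemma ballCutoff_le_one (n : ℕ) (z : E) : ballCutoff n z ≤ 1 :=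
  max_le zero_le_one (min_le_left _ _)

lemma ballCutoff_eq_one {n : ℕ} {z : E} (h : ‖z‖ ≤ n) : ballCutoff n z = 1 := by
  rw [ballCutoff, min_eq_left (by linarith), max_eq_right zero_le_one]

lemma hasCompactSupport_ballCutoff [ProperSpace E] (n : ℕ) :
    HasCompactSupport (ballCutoff n : E → ℝ) := by
  refine HasCompactSupport.intro (isCompact_closedBall 0 (n + 1)) fun z hz => ?_
  rw [mem_closedBall_zero_iff, not_le] at hz
  exact max_eq_left ((min_le_right _ _).trans (by linarith))

lemma eventually_ballCutoff_eq_one (z : E) : ∀ᶠ n : ℕ in atTop, ballCutoff n z = 1 := by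
  obtain ⟨N, hN⟩ := exists_nat_ge ‖z‖
  filter_upwards [eventually_ge_atTop N] with n hn
  exact ballCutoff_eq_one (hN.trans (by exact_mod_cast hn))

/-- The product of a continuous function with a cutoff. -/
noncomputable def cutoffMul [ProperSpace E] (n : ℕ) (G : C(E, ℝ)) : C_c(E, ℝ) where
  toFun z := ballCutoff n z * G z
  continuous_toFun := (continuous_ballCutoff n).mul G.continuous
  hasCompactSupport' := (hasCompactSupport_ballCutoff n).mul_right

@[simp]
lemma cutoffMul_apply [ProperSpace E] (n : ℕ) (G : C(E, ℝ)) (z : E) :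
    cutoffMul n G z = ballCutoff n z * G z := rfl

end BallCutoff

/-- The tails of the first moment, as integrals of cut off functions. -/
lemma tendsto_integral_norm_tail {E : Type*} [NormedAddCommGroup E] [MeasurableSpace E]
    [BorelSpace E] {μ : Measure E} [IsFiniteMeasure μ]
    (hμ : Integrable (fun x => ‖x‖) μ) (A : ℝ) :
    Tendsto (fun n : ℕ => ∫ x, {x : E | (n : ℝ) < ‖x‖}.indicator (fun x => A * (1 + ‖x‖)) x ∂μ)
      atTop (𝓝 0) := by
  have hInt : Integrable (fun x : E => A * (1 + ‖x‖)) μ :=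
    ((integrable_const 1).add hμ).const_mul A
  rw [← integral_zero E ℝ (μ := μ)]
  refine tendsto_integral_of_dominated_convergence (fun x => ‖A * (1 + ‖x‖)‖) (fun n => ?_)
    hInt.norm (fun n => ?_) ?_
  · exact hInt.aestronglyMeasurable.indicator (measurableSet_lt measurable_const measurable_norm)
  · exact Eventually.of_forall fun x => norm_indicator_le_norm_self _ _
  · refine Eventually.of_forall fun x => tendsto_const_nhds.congr' ?_
    obtain ⟨N, hN⟩ := exists_nat_ge ‖x‖
    filter_upwards [eventually_ge_atTop N] with n hn
    refine (indicator_of_notMem ?_ _).symm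
    simpa using hN.trans (by exact_mod_cast hn)

/-- `π` integrates compactly supported functions below `φ(x) + ψ(y) + ⟪h(x), y - x⟫` to at most
`∫ φ dμ + ∫ ψ dν`. -/
def IsSubMartingaleDual {d : ℕ} (π : Measure (Rd d × Rd d)) (μ ν : Measure (Rd d)) : Prop :=
  ∀ (φ ψ : Rd d → ℝ) (h : Rd d → Rd d) (F : C_c(Rd d × Rd d, ℝ)),
    Integrable φ μ → Integrable ψ ν →
    (∀ x y, F (x, y) ≤ φ x + ψ y + inner ℝ (h x) (y - x)) →
    ∫ z, F z ∂π ≤ ∫ x, φ x ∂μ + ∫ y, ψ y ∂ν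

namespace IsSubMartingaleDual

variable {d : ℕ} {π : Measure (Rd d × Rd d)} {μ ν : Measure (Rd d)}
  [IsProbabilityMeasure μ] [IsFiniteMeasureOnCompacts π]

lemma integrable_one_add_norm (hπ : IsSubMartingaleDual π μ ν)
    (hμ : Integrable (fun x => ‖x‖) μ) (hν : Integrable (fun x => ‖x‖) ν) :
    Integrable (fun z => 1 + ‖z‖) π := by
  let G : C(Rd d × Rd d, ℝ) := ⟨fun z => 1 + ‖z‖, by fun_prop⟩
  refine (aecover_closedBall (x := 0) tendsto_natCast_atTop_atTop).integrable_of_integral_norm_bounded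
    (l := atTop) (φ := fun n : ℕ => Metric.closedBall 0 (n : ℝ))
    (∫ x, (1 + ‖x‖) ∂μ + ∫ y, ‖y‖ ∂ν) (fun n => ?_) (Eventually.of_forall fun n => ?_)
  · exact G.continuous.continuousOn.integrableOn_compact (isCompact_closedBall _ _)
  · have hle : ∫ z, cutoffMul n G z ∂π ≤ ∫ x, (1 + ‖x‖) ∂μ + ∫ y, ‖y‖ ∂ν := by
      refine hπ _ _ 0 _ ((integrable_const 1).add hμ) hν fun x y => ?_
      have h₁ : cutoffMul n G (x, y) ≤ 1 + ‖(x, y)‖ :=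
        mul_le_of_le_one_left (add_nonneg zero_le_one (norm_nonneg _)) (ballCutoff_le_one n _)
      have h₂ : ‖(x, y)‖ ≤ ‖x‖ + ‖y‖ :=
        max_le (by linarith [norm_nonneg y]) (by linarith [norm_nonneg x])
      simp only [Pi.zero_apply, inner_zero_left]
      linarith
    refine le_trans ?_ hle
    have hInt : Integrable (cutoffMul n G) π :=
      (cutoffMul n G).continuous.integrable_of_hasCompactSupport (cutoffMul n G).hasCompactSupport
    refine le_trans (le_of_eq ?_) (setIntegral_le_integral (s := Metric.closedBall 0 (n : ℝ)) hInt
      (Eventually.of_forall fun z => mul_nonneg (ballCutoff_nonneg n z) ?_))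
    · refine setIntegral_congr_fun Metric.isClosed_closedBall.measurableSet fun z hz => ?_
      rw [mem_closedBall_zero_iff] at hz
      simp only [cutoffMul_apply, ballCutoff_eq_one hz, one_mul]
      exact Real.norm_of_nonneg (by positivity)
    · exact add_nonneg zero_le_one (norm_nonneg z)

lemma integrable_of_le (hπ : IsSubMartingaleDual π μ ν)
    (hμ : Integrable (fun x => ‖x‖) μ) (hν : Integrable (fun x => ‖x‖) ν)
    {E : Type*} [NormedAddCommGroup E] {G : Rd d × Rd d → E} (hG : AEStronglyMeasurable G π)
    {A : ℝ} (hA : ∀ z, ‖G z‖ ≤ A * (1 + ‖z‖)) : Integrable G π :=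
  ((hπ.integrable_one_add_norm hμ hν).const_mul A).mono' hG (Eventually.of_forall hA)

lemma isFiniteMeasure (hπ : IsSubMartingaleDual π μ ν)
    (hμ : Integrable (fun x => ‖x‖) μ) (hν : Integrable (fun x => ‖x‖) ν) :
    IsFiniteMeasure π := by
  have h : Integrable (fun _ => (1 : ℝ)) π :=
    hπ.integrable_of_le hμ hν aestronglyMeasurable_const (A := 1) (fun z => by simp)
  exact (integrable_const_iff_isFiniteMeasure one_ne_zero).1 h

variable [IsProbabilityMeasure ν]

lemma integral_le (hπ : IsSubMartingaleDual π μ ν)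
    (hμ : Integrable (fun x => ‖x‖) μ) (hν : Integrable (fun x => ‖x‖) ν)
    {φ ψ : Rd d → ℝ} {h : Rd d → Rd d} (hφ : Integrable φ μ) (hψ : Integrable ψ ν)
    {G : Rd d × Rd d → ℝ} (hGc : Continuous G) {A : ℝ} (hA : ∀ z, ‖G z‖ ≤ A * (1 + ‖z‖))
    (hG : ∀ x y, G (x, y) = φ x + ψ y + inner ℝ (h x) (y - x)) :
    ∫ z, G z ∂π ≤ ∫ x, φ x ∂μ + ∫ y, ψ y ∂ν := by
  let a (n : ℕ) (x : Rd d) : ℝ := {x : Rd d | (n : ℝ) < ‖x‖}.indicator (fun x => A * (1 + ‖x‖)) x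
  have hA₀ : 0 ≤ A := by simpa using (norm_nonneg _).trans (hA 0)
  have ha₀ (n : ℕ) (x : Rd d) : 0 ≤ a n x := indicator_nonneg (fun x _ => by positivity) x
  have haint {ρ : Measure (Rd d)} [IsProbabilityMeasure ρ] (hρ : Integrable (fun x => ‖x‖) ρ)
      (n : ℕ) : Integrable (a n) ρ :=
    (((integrable_const 1).add hρ).const_mul A).indicator
      (measurableSet_lt measurable_const measurable_norm)
  have hbound (n : ℕ) : ∫ z, ballCutoff n z * G z ∂π ≤
      (∫ x, φ x ∂μ + ∫ x, a n x ∂μ) + (∫ y, ψ y ∂ν + ∫ y, a n y ∂ν) := by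
    rw [← integral_add hφ (haint hμ n), ← integral_add hψ (haint hν n)]
    refine hπ _ _ h (cutoffMul n ⟨G, hGc⟩) (hφ.add (haint hμ n)) (hψ.add (haint hν n))
      fun x y => ?_
    have htail : ballCutoff n (x, y) * G (x, y) ≤ G (x, y) + (a n x + a n y) := by
      rcases le_or_gt ‖(x, y)‖ n with hz | hz
      · rw [ballCutoff_eq_one hz, one_mul]
        linarith [ha₀ n x, ha₀ n y]
      · have h₁ : A * (1 + ‖(x, y)‖) ≤ a n x + a n y := by
          rcases max_choice ‖x‖ ‖y‖ with hm | hm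
          · have he : ‖(x, y)‖ = ‖x‖ := hm
            rw [he] at hz ⊢
            have : a n x = A * (1 + ‖x‖) := indicator_of_mem (s := {x : Rd d | (n : ℝ) < ‖x‖}) hz _
            linarith [ha₀ n y]
          · have he : ‖(x, y)‖ = ‖y‖ := hm
            rw [he] at hz ⊢
            have : a n y = A * (1 + ‖y‖) := indicator_of_mem (s := {x : Rd d | (n : ℝ) < ‖x‖}) hz _
            linarith [ha₀ n x]
        have h₂ := (hA (x, y)).trans h₁
        rw [Real.norm_eq_abs] at h₂
        have h₃ : (1 - ballCutoff n (x, y)) * (-G (x, y)) ≤ 1 * |G (x, y)| :=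
          (mul_le_mul_of_nonneg_left (neg_le_abs _)
            (by linarith [ballCutoff_le_one n (x, y)])).trans
            (mul_le_mul_of_nonneg_right (by linarith [ballCutoff_nonneg n (x, y)]) (abs_nonneg _))
        linarith
    have := hG x y
    change ballCutoff n (x, y) * G (x, y) ≤ φ x + a n x + (ψ y + a n y) + _
    linarith
  have hlim : Tendsto (fun n : ℕ => ∫ z, ballCutoff n z * G z ∂π) atTop (𝓝 (∫ z, G z ∂π)) := by
    refine tendsto_integral_of_dominated_convergence (fun z => ‖G z‖)
      (fun n => ((continuous_ballCutoff n).mul hGc).aestronglyMeasurable)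
      (hπ.integrable_of_le hμ hν hGc.aestronglyMeasurable hA).norm
      (fun n => Eventually.of_forall fun z => ?_) (Eventually.of_forall fun z => ?_)
    · rw [norm_mul, Real.norm_of_nonneg (ballCutoff_nonneg n z)]
      exact mul_le_of_le_one_left (norm_nonneg _) (ballCutoff_le_one n z)
    · refine tendsto_const_nhds.congr' ?_
      filter_upwards [eventually_ballCutoff_eq_one z] with n hn
      rw [hn, one_mul]
  refine le_of_tendsto_of_tendsto' hlim ?_ hbound
  simpa using ((tendsto_integral_norm_tail hμ A).const_add (∫ x, φ x ∂μ)).add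
    ((tendsto_integral_norm_tail hν A).const_add (∫ y, ψ y ∂ν))

lemma integral_eq (hπ : IsSubMartingaleDual π μ ν)
    (hμ : Integrable (fun x => ‖x‖) μ) (hν : Integrable (fun x => ‖x‖) ν)
    {φ ψ : Rd d → ℝ} {h : Rd d → Rd d} (hφ : Integrable φ μ) (hψ : Integrable ψ ν)
    {G : Rd d × Rd d → ℝ} (hGc : Continuous G) {A : ℝ} (hA : ∀ z, ‖G z‖ ≤ A * (1 + ‖z‖))
    (hG : ∀ x y, G (x, y) = φ x + ψ y + inner ℝ (h x) (y - x)) :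
    ∫ z, G z ∂π = ∫ x, φ x ∂μ + ∫ y, ψ y ∂ν := by
  refine le_antisymm (hπ.integral_le hμ hν hφ hψ hGc hA hG) ?_
  have hneg := hπ.integral_le hμ hν (h := -h) hφ.neg hψ.neg hGc.neg (A := A)
    (fun z => by simpa using hA z) (fun x y => by
      simp only [Pi.neg_apply, hG x y, inner_neg_left]
      ring)
  simp only [Pi.neg_apply, integral_neg] at hneg
  linarith

lemma map_fst (hπ : IsSubMartingaleDual π μ ν)
    (hμ : Integrable (fun x => ‖x‖) μ) (hν : Integrable (fun x => ‖x‖) ν) :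
    π.map Prod.fst = μ := by
  have := hπ.isFiniteMeasure hμ hν
  refine ext_of_forall_integral_eq_of_IsFiniteMeasure fun f => ?_
  rw [integral_map measurable_fst.aemeasurable f.continuous.aestronglyMeasurable]
  simpa using hπ.integral_eq hμ hν (h := 0) (f.integrable μ) (integrable_zero _ ℝ ν)
    (G := fun z => f z.1) (by fun_prop) (A := ‖f‖)
    (fun z => (f.norm_coe_le_norm _).trans
      (le_mul_of_one_le_right (norm_nonneg f) (by linarith [norm_nonneg z])))
    (fun x y => by simp)

lemma map_snd (hπ : IsSubMartingaleDual π μ ν)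
    (hμ : Integrable (fun x => ‖x‖) μ) (hν : Integrable (fun x => ‖x‖) ν) :
    π.map Prod.snd = ν := by
  have := hπ.isFiniteMeasure hμ hν
  refine ext_of_forall_integral_eq_of_IsFiniteMeasure fun f => ?_
  rw [integral_map measurable_snd.aemeasurable f.continuous.aestronglyMeasurable]
  simpa using hπ.integral_eq hμ hν (h := 0) (integrable_zero _ ℝ μ) (f.integrable ν)
    (G := fun z => f z.2) (by fun_prop) (A := ‖f‖)
    (fun z => (f.norm_coe_le_norm _).trans
      (le_mul_of_one_le_right (norm_nonneg f) (by linarith [norm_nonneg z])))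
    (fun x y => by simp)

lemma isProbabilityMeasure (hπ : IsSubMartingaleDual π μ ν)
    (hμ : Integrable (fun x => ‖x‖) μ) (hν : Integrable (fun x => ‖x‖) ν) :
    IsProbabilityMeasure π := by
  refine ⟨?_⟩
  rw [← preimage_univ (f := Prod.fst), ← Measure.map_apply measurable_fst .univ,
    hπ.map_fst hμ hν, measure_univ]

lemma integral_smul_sub_eq_zero (hπ : IsSubMartingaleDual π μ ν)
    (hμ : Integrable (fun x => ‖x‖) μ) (hν : Integrable (fun x => ‖x‖) ν)
    {g : Rd d → ℝ} (hg : Continuous g) (hgs : HasCompactSupport g) :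
    Integrable (fun z : Rd d × Rd d => g z.1 • (z.2 - z.1)) π ∧
      ∫ z, g z.1 • (z.2 - z.1) ∂π = 0 := by
  obtain ⟨C, hC⟩ := hgs.exists_bound_of_continuous hg
  have hC₀ : 0 ≤ C := (norm_nonneg _).trans (hC 0)
  have hnorm (z : Rd d × Rd d) : ‖g z.1 • (z.2 - z.1)‖ ≤ (2 * C) * (1 + ‖z‖) := by
    have h₁ : ‖z.2 - z.1‖ ≤ 2 * (1 + ‖z‖) := by
      linarith [norm_sub_le z.2 z.1, norm_fst_le z, norm_snd_le z]
    rw [norm_smul, mul_comm 2 C, mul_assoc]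
    exact mul_le_mul (hC _) h₁ (norm_nonneg _) hC₀
  have hcont : Continuous fun z : Rd d × Rd d => g z.1 • (z.2 - z.1) := by fun_prop
  have hInt := hπ.integrable_of_le hμ hν hcont.aestronglyMeasurable hnorm
  refine ⟨hInt, ext_inner_left ℝ fun v => ?_⟩
  rw [← integral_inner hInt, inner_zero_right]
  simpa using hπ.integral_eq hμ hν (h := fun x => g x • v) (integrable_zero _ ℝ μ)
    (integrable_zero _ ℝ ν) (G := fun z => inner ℝ v (g z.1 • (z.2 - z.1))) (by fun_prop)
    (A := ‖v‖ * (2 * C)) (fun z => (norm_inner_le_norm _ _).trans (by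
      rw [mul_assoc]
      exact mul_le_mul_of_nonneg_left (hnorm z) (norm_nonneg v)))
    (fun x y => by simp [real_inner_smul_left, real_inner_smul_right])

end IsSubMartingaleDual

lemma disint_of_isFiniteMeasure {X Y : Type*} [MeasurableSpace X] [MeasurableSpace Y]
    [StandardBorelSpace Y] [Nonempty Y] (π : Measure (X × Y)) [h : IsFiniteMeasure π] :
    disint π = π.condKernel := dif_pos h

lemma IsCoupling.fst_eq {X Y : Type*} [MeasurableSpace X] [MeasurableSpace Y]
    {π : Measure (X × Y)} {μ : Measure X} {ν : Measure Y} (h : IsCoupling π μ ν) : π.fst = μ :=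
  h.2.1

/-- In convex order, there is a martingale coupling. -/
lemma ConvexOrder.exists_martingale_coupling {d : ℕ} {μ ν : Measure (Rd d)}
    [IsProbabilityMeasure μ] [IsProbabilityMeasure ν] (hc : ConvexOrder μ ν)
    (hμ : Integrable (fun x => ‖x‖) μ) (hν : Integrable (fun x => ‖x‖) ν) :
    ∃ π : Measure (Rd d × Rd d), IsCoupling π μ ν ∧
      ∀ᵐ x ∂μ, x = ∫ y, y ∂(disint π x) := by
  obtain ⟨Λ, hΛ⟩ := hc.exists_positiveLinearMap
  set π := RealRMK.rieszMeasure Λ with hπdef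
  have hdual : IsSubMartingaleDual π μ ν := fun φ ψ h F hφ hψ hle => by
    rw [hπdef, RealRMK.integral_rieszMeasure]
    exact hΛ φ ψ h F hφ hψ hle
  have hprob := hdual.isProbabilityMeasure hμ hν
  have hfst : π.fst = μ := hdual.map_fst hμ hν
  refine ⟨π, ⟨hprob, hdual.map_fst hμ hν, hdual.map_snd hμ hν⟩, ?_⟩
  rw [disint_of_isFiniteMeasure]
  have hsnd : Integrable (fun z : Rd d × Rd d => z.2) π :=
    hdual.integrable_of_le hμ hν (by fun_prop) (A := 1) (fun z => by
      linarith [norm_snd_le z])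
  have hsndK : ∀ᵐ x ∂μ, Integrable (fun y => y) (π.condKernel x) := by
    rw [← hfst]
    exact hsnd.condKernel_ae
  have hmean : Integrable (fun x => ∫ y, y ∂π.condKernel x) μ := by
    rw [← hfst]
    exact hsnd.integral_condKernel
  have hid : Integrable (fun x : Rd d => x) μ := (integrable_norm_iff (by fun_prop)).1 hμ
  have hzero := ae_eq_zero_of_integral_contDiff_smul_eq_zero (hmean.sub hid).locallyIntegrable
    fun g hg hgs => by
      obtain ⟨hInt, h₀⟩ := hdual.integral_smul_sub_eq_zero hμ hν hg.continuous hgs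
      rw [← Measure.integral_condKernel hInt, hfst] at h₀
      rw [← h₀]
      refine integral_congr_ae ?_
      filter_upwards [hsndK] with x hx
      rw [integral_smul, integral_sub hx (integrable_const x), integral_const, probReal_univ,
        one_smul]
      rfl
  filter_upwards [hzero] with x hx
  exact (sub_eq_zero.1 hx).symm

/-- A real convex function on a Euclidean space has at most linear decay. -/
lemma ConvexOn.exists_neg_mul_one_add_norm_le {E : Type*} [NormedAddCommGroup E]
    [NormedSpace ℝ E] [FiniteDimensional ℝ E] {f : E → ℝ} (hf : ConvexOn ℝ univ f) :
    ∃ C : ℝ, ∀ x, -(C * (1 + ‖x‖)) ≤ f x := by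
  have hcont : Continuous f := hf.locallyLipschitz.continuous
  obtain ⟨C, hC⟩ := (isCompact_closedBall (0 : E) 1).exists_bound_of_continuousOn
    hcont.continuousOn
  have hC₀ : 0 ≤ C := (norm_nonneg _).trans (hC 0 (by simp))
  refine ⟨3 * C, fun x => ?_⟩
  have hn : 0 < 1 + ‖x‖ := by positivity
  have hball : -(1 + ‖x‖)⁻¹ • x ∈ Metric.closedBall (0 : E) 1 := by
    rw [mem_closedBall_zero_iff, neg_smul, norm_neg, norm_smul, norm_inv, Real.norm_of_nonneg hn.le,
      inv_mul_le_iff₀ hn]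
    linarith
  have hzero : (2 + ‖x‖)⁻¹ • x + ((1 + ‖x‖) * (2 + ‖x‖)⁻¹) • (-(1 + ‖x‖)⁻¹ • x) = 0 := by
    rw [smul_smul, ← add_smul]
    convert zero_smul ℝ x using 2
    field_simp
    ring
  have hle := hf.2 (mem_univ x) (mem_univ (-(1 + ‖x‖)⁻¹ • x))
    (show 0 ≤ (2 + ‖x‖)⁻¹ by positivity) (show 0 ≤ (1 + ‖x‖) * (2 + ‖x‖)⁻¹ by positivity)
    (by field_simp; ring)
  rw [hzero, smul_eq_mul, smul_eq_mul] at hle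
  have h₀ := (abs_le.1 (hC 0 (by simp))).1
  have h₁ := (abs_le.1 (hC _ hball)).2
  have h₂ := mul_le_mul_of_nonneg_left hle (by positivity : 0 ≤ 2 + ‖x‖)
  have h₃ (u v : ℝ) : (2 + ‖x‖) * ((2 + ‖x‖)⁻¹ * u + (1 + ‖x‖) * (2 + ‖x‖)⁻¹ * v) =
      u + (1 + ‖x‖) * v := by
    field_simp
  rw [h₃] at h₂
  nlinarith [mul_le_mul_of_nonneg_left h₁ hn.le,
    mul_le_mul_of_nonneg_left h₀ (by positivity : 0 ≤ 2 + ‖x‖), mul_nonneg hC₀ (norm_nonneg x)]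

lemma integrable_of_lintegral_ofReal_ne_top {α : Type*} [MeasurableSpace α] {μ : Measure α}
    {f : α → ℝ} (hf : Measurable f) (hpos : ∫⁻ x, ENNReal.ofReal (f x) ∂μ ≠ ⊤)
    (hneg : ∫⁻ x, ENNReal.ofReal (-f x) ∂μ ≠ ⊤) : Integrable f μ := by
  refine ⟨hf.aestronglyMeasurable, ?_⟩
  rw [hasFiniteIntegral_iff_norm]
  refine lt_of_le_of_lt (lintegral_mono fun x => ?_)
    ((lintegral_add_left hf.ennreal_ofReal fun x => ENNReal.ofReal (-f x)).trans_lt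
      (ENNReal.add_lt_top.2 ⟨hpos.lt_top, hneg.lt_top⟩))
  rcases le_total 0 (f x) with h | h
  · rw [Real.norm_of_nonneg h]
    exact le_self_add
  · rw [Real.norm_of_nonpos h]
    exact le_add_self

/-- Jensen's inequality for a martingale coupling and a convex function integrable against the
second marginal. -/
lemma IsCoupling.integral_le_of_convexOn {d : ℕ} {π : Measure (Rd d × Rd d)}
    {μ ν : Measure (Rd d)} (hπ : IsCoupling π μ ν) (hν : Integrable (fun y => y) ν)
    (hmart : ∀ᵐ x ∂μ, x = ∫ y, y ∂(disint π x)) {f : Rd d → ℝ} (hf : ConvexOn ℝ univ f)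
    (hfν : Integrable f ν) : eInt μ (fun x => (f x : EReal)) ≤ eInt ν (fun y => (f y : EReal)) := by
  have hprob := hπ.1
  have hfst := hπ.fst_eq
  have hcont : Continuous f := hf.locallyLipschitz.continuous
  rw [disint_of_isFiniteMeasure] at hmart
  have hsnd {E : Type} [NormedAddCommGroup E] {g : Rd d → E} (hg : Integrable g ν) :
      Integrable (fun z : Rd d × Rd d => g z.2) π := by
    rw [← hπ.2.2] at hg
    exact hg.comp_measurable measurable_snd
  have hfK : ∀ᵐ x ∂μ, Integrable f (π.condKernel x) := by
    rw [← hfst]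
    exact (hsnd hfν).condKernel_ae
  have hidK : ∀ᵐ x ∂μ, Integrable (fun y => y) (π.condKernel x) := by
    rw [← hfst]
    exact (hsnd hν).condKernel_ae
  have hmean : Integrable (fun x => ∫ y, f y ∂π.condKernel x) μ := by
    rw [← hfst]
    exact (hsnd hfν).integral_condKernel
  have hjensen : ∀ᵐ x ∂μ, f x ≤ ∫ y, f y ∂π.condKernel x := by
    filter_upwards [hmart, hfK, hidK] with x hx hfx hidx
    conv_lhs => rw [hx]
    exact hf.map_integral_le hcont.continuousOn isClosed_univ (by simp) hidx hfx
  have htot : ∫ x, ∫ y, f y ∂π.condKernel x ∂μ = ∫ y, f y ∂ν := by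
    rw [← hπ.2.2, integral_map measurable_snd.aemeasurable hcont.aestronglyMeasurable,
      ← Measure.integral_condKernel (hsnd hfν), hfst]
  have hmono := eInt_coe_mono hjensen
  rwa [eInt_coe_of_integrable hmean, htot, ← eInt_coe_of_integrable hfν] at hmono

lemma convexOrder_of_isCoupling {d : ℕ} {π : Measure (Rd d × Rd d)} {μ ν : Measure (Rd d)}
    [IsProbabilityMeasure ν] (hν : Integrable (fun x => ‖x‖) ν) (hπ : IsCoupling π μ ν)
    (hmart : ∀ᵐ x ∂μ, x = ∫ y, y ∂(disint π x)) : ConvexOrder μ ν := by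
  intro f hf
  by_cases hfν : Integrable f ν
  · exact hπ.integral_le_of_convexOn ((integrable_norm_iff (by fun_prop)).1 hν) hmart hf hfν
  obtain ⟨C, hC⟩ := hf.exists_neg_mul_one_add_norm_le
  have hcont : Continuous f := hf.locallyLipschitz.continuous
  have hneg : ∫⁻ x, ENNReal.ofReal (-f x) ∂ν ≠ ⊤ := by
    have hInt : Integrable (fun x => C * (1 + ‖x‖)) ν :=
      ((integrable_const 1).add hν).const_mul C
    exact ((lintegral_mono fun x => ENNReal.ofReal_le_ofReal (by linarith [hC x])).trans_lt
      hInt.lintegral_lt_top).ne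
  have hpos : ∫⁻ x, ENNReal.ofReal (f x) ∂ν = ⊤ := by
    by_contra h
    exact hfν (integrable_of_lintegral_ofReal_ne_top hcont.measurable h hneg)
  rw [eInt_coe ν, hpos, EReal.coe_ennreal_top, EReal.top_sub (by simpa using hneg)]
  exact le_top

/-- **Strassen's theorem for martingales**: for `μ, ν ∈ P₁(ℝ^d)`, `μ ≼_c ν` if and only if
there is a coupling `π ∈ Π(μ,ν)` with `x = mean(π_x)` for `μ`-a.e. `x`. -/
theorem strassen_martingale {d : ℕ} (μ ν : Measure (Rd d))
    (hμ : IsProbabilityMeasure μ) (hν : IsProbabilityMeasure ν)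
    (hμ1 : HasMomentP 1 μ) (hν1 : HasMomentP 1 ν) :
    ConvexOrder μ ν ↔
      ∃ π : Measure (Rd d × Rd d), IsCoupling π μ ν ∧
        ∀ᵐ x ∂μ, x = ∫ y, y ∂(disint π x) := by
  constructor
  · intro hc
    exact hc.exists_martingale_coupling hμ1.integrable_norm hν1.integrable_norm
  · rintro ⟨π, hπ, hmart⟩
    exact convexOrder_of_isCoupling hν1.integrable_norm hπ hmart
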